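/- arXiv:1302.1736 — 2 statements merged into one kernel-verified Lean document; each statement's English description precedes it below -/
import Mathlib

section
/- Let B be the unweighted backward shift on l^∞(ℕ) and let λ ∈ ℂ with |λ| > 2. Then the set A_{I+λB}^mix = {x ∈ l^∞(ℕ) : J_{I+λB}^mix(x) = l^∞(ℕ)} equals c₀(ℕ). -/
open Filter Topology
open scoped ENNReal

/-- The unweighted backward shift on `l^∞(ℕ)`, the space of bounded sequences of
complex numbers with the supremum norm. -/
noncomputable def backwardShift : lp (fun _ : ℕ => ℂ) ∞ →L[ℂ] lp (fun _ : ℕ => ℂ) ∞ :=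
  LinearMap.mkContinuous
    { toFun := fun x => ⟨fun n => x (n + 1), memℓp_infty ⟨‖x‖, by
        rintro r ⟨n, rfl⟩
        exact lp.norm_apply_le_norm ENNReal.top_ne_zero x (n + 1)⟩⟩
      map_add' := fun x y => by ext n; exact congrFun rfl n
      map_smul' := fun c x => by ext n; rfl }
    1
    (fun x => by
      rw [one_mul]
      apply lp.norm_le_of_forall_le (norm_nonneg x)
      intro n
      exact lp.norm_apply_le_norm ENNReal.top_ne_zero x (n + 1))

/-- The extended mixing limit set `J_T^mix(x)`: all `y` for which there exists a
sequence `(x_n)` with `x_n → x` and `T^n x_n → y`. -/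
noncomputable def Jmix {X : Type*} [SeminormedAddCommGroup X] [NormedSpace ℂ X]
    (T : X →L[ℂ] X) (x : X) : Set X :=
  {y | ∃ u : ℕ → X, Tendsto u atTop (𝓝 x) ∧ Tendsto (fun n => (T ^ n) (u n)) atTop (𝓝 y)}

/-- The operator `I + λB`, evaluated at a coordinate. -/
lemma one_add_smul_backwardShift_apply (lam : ℂ) (a : lp (fun _ : ℕ => ℂ) ∞) (i : ℕ) :
    ((1 + lam • backwardShift) a) i = a i + lam * a (i + 1) := rfl

/-- `I + λB` has preimages with norm control, for `|λ| > 1`. -/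
lemma exists_preimage_norm_le {lam : ℂ} (hlam : 1 < ‖lam‖) (y : lp (fun _ : ℕ => ℂ) ∞) :
    ∃ z, (1 + lam • backwardShift) z = y ∧ ‖z‖ ≤ (‖lam‖ - 1)⁻¹ * ‖y‖ := by
  have h0 : 0 < ‖lam‖ - 1 := by linarith
  have hl : lam ≠ 0 := norm_pos_iff.mp (by linarith)
  let f : ℕ → ℂ := fun n => Nat.rec 0 (fun i w => (y i - w) / lam) n
  have hf : ∀ i, f (i + 1) = (y i - f i) / lam := fun _ => rfl
  have hb : ∀ i, ‖f i‖ ≤ (‖lam‖ - 1)⁻¹ * ‖y‖ := by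
    intro i
    induction i with
    | zero =>
      have : f 0 = 0 := rfl
      rw [this, norm_zero]
      positivity
    | succ i ih =>
      rw [hf, norm_div, div_le_iff₀ (by linarith)]
      calc ‖y i - f i‖ ≤ ‖y i‖ + ‖f i‖ := norm_sub_le _ _
        _ ≤ ‖y‖ + (‖lam‖ - 1)⁻¹ * ‖y‖ :=
          add_le_add (lp.norm_apply_le_norm ENNReal.top_ne_zero y i) ih
        _ = (‖lam‖ - 1)⁻¹ * ‖y‖ * ‖lam‖ := by field_simp; ring
  refine ⟨⟨f, memℓp_infty ⟨_, Set.forall_mem_range.2 hb⟩⟩, ?_, ?_⟩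
  · ext i
    rw [one_add_smul_backwardShift_apply]
    change f i + lam * f (i + 1) = y i
    rw [hf]
    field_simp
    ring
  · exact lp.norm_le_of_forall_le (by positivity) hb

lemma exists_pow_preimage_norm_le {lam : ℂ} (hlam : 1 < ‖lam‖) (n : ℕ)
    (y : lp (fun _ : ℕ => ℂ) ∞) :
    ∃ z, ((1 + lam • backwardShift) ^ n) z = y ∧ ‖z‖ ≤ (‖lam‖ - 1)⁻¹ ^ n * ‖y‖ := by
  have h0 : 0 < ‖lam‖ - 1 := by linarith
  induction n with
  | zero => exact ⟨y, by simp, by simp⟩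
  | succ n ih =>
    obtain ⟨w, hw, hwn⟩ := ih
    obtain ⟨z, hz, hzn⟩ := exists_preimage_norm_le hlam w
    refine ⟨z, ?_, ?_⟩
    · rw [pow_succ, mul_apply_eq_comp, hz, hw]
    · calc ‖z‖ ≤ (‖lam‖ - 1)⁻¹ * ‖w‖ := hzn
        _ ≤ (‖lam‖ - 1)⁻¹ * ((‖lam‖ - 1)⁻¹ ^ n * ‖y‖) := by gcongr
        _ = (‖lam‖ - 1)⁻¹ ^ (n + 1) * ‖y‖ := by ring

/-- If `(I + λB) a` is a null sequence and `|λ| ≥ 2`, then `a` is a null sequence. -/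
lemma tendsto_zero_of_one_add_smul_backwardShift {lam : ℂ} (hlam : 2 ≤ ‖lam‖)
    (a : lp (fun _ : ℕ => ℂ) ∞)
    (h : Tendsto (fun i => ((1 + lam • backwardShift) a) i) atTop (𝓝 0)) :
    Tendsto (fun i => a i) atTop (𝓝 0) := by
  have key : ∀ m : ℕ, ∀ᶠ i in atTop, ‖a i‖ ≤ (‖a‖ + 1) * (3 / 4 : ℝ) ^ m := by
    intro m
    induction m with
    | zero =>
      refine Eventually.of_forall fun i => ?_
      have := lp.norm_apply_le_norm ENNReal.top_ne_zero a i
      simp only [pow_zero, mul_one]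
      linarith
    | succ m ih =>
      have hs : 0 < (‖a‖ + 1) * (3 / 4 : ℝ) ^ m := by positivity
      rw [pow_succ, ← mul_assoc]
      set s := (‖a‖ + 1) * (3 / 4 : ℝ) ^ m
      have hb : ∀ᶠ i in atTop, ‖((1 + lam • backwardShift) a) i‖ < s / 2 :=
        (tendsto_zero_iff_norm_tendsto_zero.1 h).eventually_lt_const (half_pos hs)
      rw [← map_add_atTop_eq_nat 1, eventually_map]
      filter_upwards [ih, hb] with i h1 h2
      rw [one_add_smul_backwardShift_apply] at h2
      have h3 : ‖lam‖ * ‖a (i + 1)‖ ≤ ‖a i + lam * a (i + 1)‖ + ‖a i‖ := by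
        rw [← norm_mul]
        have := norm_sub_le (a i + lam * a (i + 1)) (a i)
        rwa [add_sub_cancel_left] at this
      have := mul_le_mul_of_nonneg_right hlam (norm_nonneg (a (i + 1)))
      linarith
  have hlim : Tendsto (fun m : ℕ => (‖a‖ + 1) * (3 / 4 : ℝ) ^ m) atTop (𝓝 0) := by
    simpa using (tendsto_pow_atTop_nhds_zero_of_lt_one (r := (3 / 4 : ℝ)) (by norm_num)
      (by norm_num)).const_mul (‖a‖ + 1)
  rw [NormedAddGroup.tendsto_nhds_zero]
  intro ε hε
  obtain ⟨m, hm⟩ := (hlim.eventually_lt_const hε).exists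
  filter_upwards [key m] with i hi using hi.trans_lt hm

lemma tendsto_zero_of_mem_ker_pow {lam : ℂ} (hlam : 2 ≤ ‖lam‖) (n : ℕ)
    (a : lp (fun _ : ℕ => ℂ) ∞) (h : ((1 + lam • backwardShift) ^ n) a = 0) :
    Tendsto (fun i => a i) atTop (𝓝 0) := by
  induction n generalizing a with
  | zero =>
    have : a = 0 := by simpa using h
    simp [this]
  | succ n ih =>
    rw [pow_succ, mul_apply_eq_comp] at h
    exact tendsto_zero_of_one_add_smul_backwardShift hlam a (ih _ h)

/-- A norm limit of null sequences is a null sequence. -/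
lemma tendsto_zero_of_tendsto_lp {v : ℕ → lp (fun _ : ℕ => ℂ) ∞} {x : lp (fun _ : ℕ => ℂ) ∞}
    (hv : ∀ n, Tendsto (fun i => v n i) atTop (𝓝 0)) (hx : Tendsto v atTop (𝓝 x)) :
    Tendsto (fun i => x i) atTop (𝓝 0) := by
  rw [NormedAddGroup.tendsto_nhds_zero]
  intro ε hε
  obtain ⟨n, hn⟩ := ((tendsto_iff_norm_sub_tendsto_zero.1 hx).eventually_lt_const
    (half_pos hε)).exists
  filter_upwards [NormedAddGroup.tendsto_nhds_zero.1 (hv n) _ (half_pos hε)] with i hi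
  have h1 : ‖v n i - x i‖ ≤ ‖v n - x‖ := lp.norm_apply_le_norm ENNReal.top_ne_zero (v n - x) i
  have h2 := norm_sub_le (v n i) (v n i - x i)
  rw [sub_sub_cancel] at h2
  linarith

/-- Geometric decay at rate `δ` is preserved by `I + λB`, with growth factor `1 + |λ|δ`. -/
lemma norm_pow_apply_le_of_geometric (lam : ℂ) {δ C : ℝ} (v : lp (fun _ : ℕ => ℂ) ∞)
    (hv : ∀ i, ‖v i‖ ≤ C * δ ^ i) (n i : ℕ) :
    ‖(((1 + lam • backwardShift) ^ n) v) i‖ ≤ C * (1 + ‖lam‖ * δ) ^ n * δ ^ i := by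
  induction n generalizing i with
  | zero => simpa using hv i
  | succ n ih =>
    rw [pow_succ', mul_apply_eq_comp, one_add_smul_backwardShift_apply]
    refine (norm_add_le _ _).trans ?_
    rw [norm_mul]
    calc _ ≤ C * (1 + ‖lam‖ * δ) ^ n * δ ^ i
          + ‖lam‖ * (C * (1 + ‖lam‖ * δ) ^ n * δ ^ (i + 1)) := by
            gcongr
            · exact ih i
            · exact ih (i + 1)
      _ = _ := by ring

lemma tendsto_pow_mul_norm_pow_of_finite_support {lam : ℂ} {r : ℝ} (hr0 : 0 ≤ r) (hr : r < 1)
    (v : lp (fun _ : ℕ => ℂ) ∞) (k : ℕ) (hv : ∀ i, k ≤ i → v i = 0) :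
    Tendsto (fun n => r ^ n * ‖((1 + lam • backwardShift) ^ n) v‖) atTop (𝓝 0) := by
  obtain ⟨δ, hδ0, hδ1, hδ⟩ : ∃ δ : ℝ, 0 < δ ∧ δ ≤ 1 ∧ r * (1 + ‖lam‖ * δ) < 1 := by
    have hc : Tendsto (fun δ : ℝ => r * (1 + ‖lam‖ * δ)) (𝓝[>] 0) (𝓝 r) := by
      have : Continuous (fun δ : ℝ => r * (1 + ‖lam‖ * δ)) := by fun_prop
      simpa using (this.tendsto 0).mono_left (nhdsWithin_le_nhds (s := Set.Ioi 0))
    obtain ⟨δ, h1, h2, h3⟩ := ((hc.eventually_lt_const hr).and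
      (Ioc_mem_nhdsGT (zero_lt_one (α := ℝ)))).exists
    exact ⟨δ, h2, h3, h1⟩
  have hC : ∀ i, ‖v i‖ ≤ ‖v‖ / δ ^ k * δ ^ i := by
    intro i
    rcases le_or_gt k i with h | h
    · rw [hv i h, norm_zero]; positivity
    · rw [div_mul_eq_mul_div, le_div_iff₀ (by positivity)]
      exact mul_le_mul (lp.norm_apply_le_norm ENNReal.top_ne_zero v i)
        (pow_le_pow_of_le_one hδ0.le hδ1 h.le) (by positivity) (norm_nonneg _)
  have hbound : ∀ n, r ^ n * ‖((1 + lam • backwardShift) ^ n) v‖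
      ≤ ‖v‖ / δ ^ k * (r * (1 + ‖lam‖ * δ)) ^ n := by
    intro n
    have : ‖((1 + lam • backwardShift) ^ n) v‖ ≤ ‖v‖ / δ ^ k * (1 + ‖lam‖ * δ) ^ n := by
      refine lp.norm_le_of_forall_le (by positivity) fun i => ?_
      exact (norm_pow_apply_le_of_geometric lam v hC n i).trans
        (mul_le_of_le_one_right (by positivity) (pow_le_one₀ hδ0.le hδ1))
    calc _ ≤ r ^ n * (‖v‖ / δ ^ k * (1 + ‖lam‖ * δ) ^ n) := by gcongr
      _ = _ := by rw [mul_pow]; ring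
  refine squeeze_zero (fun n => by positivity) hbound ?_
  simpa using (tendsto_pow_atTop_nhds_zero_of_lt_one (by positivity) hδ).const_mul (‖v‖ / δ ^ k)

/-- A null sequence is approximated in norm by finitely supported sequences. -/
lemma exists_finite_support_norm_sub_le {x : lp (fun _ : ℕ => ℂ) ∞}
    (hx : Tendsto (fun i => x i) atTop (𝓝 0)) {ε : ℝ} (hε : 0 < ε) :
    ∃ (v : lp (fun _ : ℕ => ℂ) ∞) (k : ℕ), (∀ i, k ≤ i → v i = 0) ∧ ‖v - x‖ ≤ ε := by
  obtain ⟨k, hk⟩ := eventually_atTop.1 (NormedAddGroup.tendsto_nhds_zero.1 hx ε hε)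
  let f : ℕ → ℂ := fun i => if i < k then x i else 0
  have hf : Memℓp f ∞ := by
    refine memℓp_infty ⟨‖x‖, Set.forall_mem_range.2 fun i => ?_⟩
    by_cases h : i < k
    · simpa [f, h] using lp.norm_apply_le_norm ENNReal.top_ne_zero x i
    · simp [f, h]
  refine ⟨⟨f, hf⟩, k, fun i hi => if_neg hi.not_gt, lp.norm_le_of_forall_le hε.le fun i => ?_⟩
  change ‖f i - x i‖ ≤ ε
  by_cases h : i < k
  · simpa [f, h] using hε.le
  · simpa [f, h] using (hk i (not_lt.1 h)).le

/-- A pointwise approximation criterion for membership in the mixing limit set. -/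
lemma mem_Jmix_of_forall_eventually {X : Type*} [SeminormedAddCommGroup X] [NormedSpace ℂ X]
    {T : X →L[ℂ] X} {x y : X} (hne : ∀ n, ∃ u, (T ^ n) u = y)
    (h : ∀ ε > 0, ∀ᶠ n in atTop, ∃ u, (T ^ n) u = y ∧ ‖u - x‖ < ε) :
    y ∈ Jmix T x := by
  have hex : ∀ n : ℕ, ∃ u, (T ^ n) u = y ∧
      dist x u < Metric.infDist x {u | (T ^ n) u = y} + 1 / ((n : ℝ) + 1) := fun n =>
    (Metric.infDist_lt_iff (s := {u | (T ^ n) u = y}) (hne n)).1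
      (lt_add_of_pos_right _ Nat.one_div_pos_of_nat)
  choose u hu hux using hex
  refine ⟨u, ?_, by simpa only [hu] using tendsto_const_nhds⟩
  have hinf : Tendsto (fun n : ℕ => Metric.infDist x {u | (T ^ n) u = y}) atTop (𝓝 0) := by
    rw [NormedAddGroup.tendsto_nhds_zero]
    intro ε hε
    filter_upwards [h ε hε] with n ⟨w, hw, hwx⟩
    rw [Real.norm_of_nonneg Metric.infDist_nonneg]
    refine (Metric.infDist_le_dist_of_mem (s := {u | (T ^ n) u = y}) hw).trans_lt ?_
    rwa [dist_comm, dist_eq_norm]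
  rw [tendsto_iff_dist_tendsto_zero]
  refine squeeze_zero (fun _ => dist_nonneg) (fun n => (dist_comm _ _).trans_le (hux n).le) ?_
  simpa using hinf.add tendsto_one_div_add_atTop_nhds_zero_nat

/-- If `|λ| > 2`, then `A_{I+λB}^mix = {x : J_{I+λB}^mix(x) = l^∞(ℕ)}` equals `c₀(ℕ)`,
the subspace of sequences converging to `0`. -/
theorem stmt2 (lam : ℂ) (hlam : 2 < ‖lam‖) :
    {x : lp (fun _ : ℕ => ℂ) ∞ | Jmix (1 + lam • backwardShift) x = Set.univ} =
      {x : lp (fun _ : ℕ => ℂ) ∞ | Tendsto (fun n => x n) atTop (𝓝 0)} := by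
  have h1 : 1 < ‖lam‖ := by linarith
  have hr0 : 0 ≤ (‖lam‖ - 1)⁻¹ := inv_nonneg.2 (by linarith)
  have hr : (‖lam‖ - 1)⁻¹ < 1 := inv_lt_one_of_one_lt₀ (by linarith)
  ext x
  simp only [Set.mem_ofPred_eq]
  constructor
  · intro hx
    obtain ⟨u, hu, hTu⟩ : (0 : lp (fun _ : ℕ => ℂ) ∞) ∈ Jmix (1 + lam • backwardShift) x :=
      hx ▸ Set.mem_univ _
    choose z hz hzn using fun n =>
      exists_pow_preimage_norm_le h1 n (((1 + lam • backwardShift) ^ n) (u n))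
    have hz0 : Tendsto z atTop (𝓝 0) := by
      refine squeeze_zero_norm (fun n => (hzn n).trans ?_) (tendsto_zero_iff_norm_tendsto_zero.1 hTu)
      exact mul_le_of_le_one_left (norm_nonneg _) (pow_le_one₀ hr0 hr.le)
    refine tendsto_zero_of_tendsto_lp (v := fun n => u n - z n) (fun n => ?_)
      (by simpa using hu.sub hz0)
    exact tendsto_zero_of_mem_ker_pow hlam.le n _ (by rw [map_sub, hz, sub_self])
  · intro hx
    refine Set.eq_univ_of_forall fun y => mem_Jmix_of_forall_eventually
      (fun n => (exists_pow_preimage_norm_le h1 n y).imp fun _ h => h.1) fun ε hε => ?_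
    obtain ⟨v, k, hvk, hvx⟩ := exists_finite_support_norm_sub_le hx (half_pos hε)
    have hlim : Tendsto (fun n => (‖lam‖ - 1)⁻¹ ^ n * ‖y‖ +
        (‖lam‖ - 1)⁻¹ ^ n * ‖((1 + lam • backwardShift) ^ n) v‖) atTop (𝓝 0) := by
      simpa using ((tendsto_pow_atTop_nhds_zero_of_lt_one hr0 hr).mul_const ‖y‖).add
        (tendsto_pow_mul_norm_pow_of_finite_support (lam := lam) hr0 hr v k hvk)
    filter_upwards [hlim.eventually_lt_const (half_pos hε)] with n hn
    obtain ⟨z, hz, hzn⟩ :=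
      exists_pow_preimage_norm_le h1 n (y - ((1 + lam • backwardShift) ^ n) v)
    refine ⟨v + z, by rw [map_add, hz, add_sub_cancel], ?_⟩
    have hle : ‖z‖ ≤ (‖lam‖ - 1)⁻¹ ^ n * ‖y‖ +
        (‖lam‖ - 1)⁻¹ ^ n * ‖((1 + lam • backwardShift) ^ n) v‖ := by
      rw [← mul_add]
      exact hzn.trans (mul_le_mul_of_nonneg_left (norm_sub_le _ _) (pow_nonneg hr0 n))
    calc ‖v + z - x‖ = ‖(v - x) + z‖ := by congr 1; abel
      _ ≤ ‖v - x‖ + ‖z‖ := norm_add_le _ _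
      _ < ε := by linarith
end

section
/- Let B be the unweighted backward shift on l^∞(ℕ) and let B̂ : l^∞(ℕ)/c₀(ℕ) → l^∞(ℕ)/c₀(ℕ) be the induced operator on the quotient Banach space, B̂[x] = [Bx]. Then the spectrum of B̂ equals the unit circle: σ(B̂) = {z ∈ ℂ : |z| = 1}. -/
open Filter Topology
open scoped ENNReal

set_option synthInstance.maxHeartbeats 1000000
set_option maxHeartbeats 1000000

/-- `c₀(ℕ)`, the subspace of `l^∞(ℕ)` of sequences converging to `0`. -/
noncomputable def c0 : Submodule ℂ (lp (fun _ : ℕ => ℂ) ∞) where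
  carrier := {x | Tendsto (fun n => x n) atTop (𝓝 0)}
  add_mem' := by
    intro a b ha hb
    simpa using ha.add hb
  zero_mem' := by simp [Set.mem_setOf_eq, lp.coeFn_zero]
  smul_mem' := by
    intro c x hx
    simpa using hx.const_smul c

theorem mem_c0_iff (x : lp (fun _ : ℕ => ℂ) ∞) :
    x ∈ c0 ↔ Tendsto (fun n => x n) atTop (𝓝 0) := Iff.rfl

theorem backwardShift_apply (x : lp (fun _ : ℕ => ℂ) ∞) (n : ℕ) :
    backwardShift x n = x (n + 1) := rfl

theorem norm_backwardShift_le (x : lp (fun _ : ℕ => ℂ) ∞) : ‖backwardShift x‖ ≤ ‖x‖ :=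
  lp.norm_le_of_forall_le (norm_nonneg x) fun n =>
    lp.norm_apply_le_norm ENNReal.top_ne_zero x (n + 1)

instance isClosed_c0 : IsClosed (c0 : Set (lp (fun _ : ℕ => ℂ) ∞)) := by
  refine isClosed_of_closure_subset fun x hx => ?_
  refine (mem_c0_iff x).2 (Metric.tendsto_atTop.2 fun ε hε => ?_)
  obtain ⟨y, hy, hxy⟩ := Metric.mem_closure_iff.1 hx (ε / 2) (half_pos hε)
  obtain ⟨N, hN⟩ := Metric.tendsto_atTop.1 ((mem_c0_iff y).1 hy) (ε / 2) (half_pos hε)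
  refine ⟨N, fun n hn => ?_⟩
  have h₁ : ‖x n - y n‖ ≤ ‖x - y‖ := lp.norm_apply_le_norm ENNReal.top_ne_zero (x - y) n
  have h₂ := hN n hn
  rw [dist_zero_right] at h₂ ⊢
  rw [dist_eq_norm] at hxy
  have h₃ : ‖x n‖ ≤ ‖x n - y n‖ + ‖y n‖ := by
    simpa using norm_add_le (x n - y n) (y n)
  linarith

/-- The forward shift `(x₀, x₁, …) ↦ (0, x₀, x₁, …)` on `l^∞(ℕ)`. -/
noncomputable def forwardShift : lp (fun _ : ℕ => ℂ) ∞ →ₗ[ℂ] lp (fun _ : ℕ => ℂ) ∞ where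
  toFun x := ⟨fun n => Nat.casesOn n 0 fun k => x k, memℓp_infty ⟨‖x‖, by
    rintro r ⟨n, rfl⟩
    cases n with
    | zero => simp
    | succ n => exact lp.norm_apply_le_norm ENNReal.top_ne_zero x n⟩⟩
  map_add' x y := by
    ext n
    cases n with
    | zero => exact (add_zero (0 : ℂ)).symm
    | succ n => rfl
  map_smul' c x := by
    ext n
    cases n with
    | zero => exact (mul_zero c).symm
    | succ n => rfl

theorem forwardShift_zero (x : lp (fun _ : ℕ => ℂ) ∞) : forwardShift x 0 = 0 := rfl

theorem forwardShift_succ (x : lp (fun _ : ℕ => ℂ) ∞) (n : ℕ) :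
    forwardShift x (n + 1) = x n := rfl

theorem norm_forwardShift_le (x : lp (fun _ : ℕ => ℂ) ∞) : ‖forwardShift x‖ ≤ ‖x‖ := by
  refine lp.norm_le_of_forall_le (norm_nonneg x) fun n => ?_
  cases n with
  | zero => rw [forwardShift_zero, norm_zero]; exact norm_nonneg x
  | succ n => exact lp.norm_apply_le_norm ENNReal.top_ne_zero x n

theorem forwardShift_mem_c0 {x : lp (fun _ : ℕ => ℂ) ∞} (hx : x ∈ c0) : forwardShift x ∈ c0 :=
  (mem_c0_iff _).2 ((tendsto_add_atTop_iff_nat 1).1 ((mem_c0_iff x).1 hx))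

theorem backwardShift_forwardShift (x : lp (fun _ : ℕ => ℂ) ∞) :
    backwardShift (forwardShift x) = x := by
  ext n
  rfl

theorem forwardShift_backwardShift_sub_mem_c0 (x : lp (fun _ : ℕ => ℂ) ∞) :
    forwardShift (backwardShift x) - x ∈ c0 := by
  refine (mem_c0_iff _).2 ((tendsto_add_atTop_iff_nat 1).1 ?_)
  refine tendsto_const_nhds.congr fun n => ?_
  exact (sub_self (x (n + 1))).symm

/-- A linear map on a quotient induced by a norm-nonincreasing map is norm-nonincreasing. -/
theorem norm_quotient_map_le {E : Type*} [SeminormedAddCommGroup E] [NormedSpace ℂ E]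
    {p : Submodule ℂ E} (T : E → E) (hT : ∀ x, ‖T x‖ ≤ ‖x‖) (L : (E ⧸ p) →ₗ[ℂ] (E ⧸ p))
    (hL : ∀ x, L (p.mkQ x) = p.mkQ (T x)) (q : E ⧸ p) : ‖L q‖ ≤ ‖q‖ := by
  refine le_of_forall_pos_le_add fun ε hε => ?_
  obtain ⟨x, rfl, hx⟩ := Submodule.Quotient.norm_mk_lt q hε
  calc ‖L (p.mkQ x)‖ = ‖p.mkQ (T x)‖ := by rw [hL]
    _ ≤ ‖T x‖ := Submodule.Quotient.norm_mk_le p _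
    _ ≤ _ := (hT x).trans hx.le

/-- The operator on `l^∞(ℕ)/c₀(ℕ)` induced by the forward shift. -/
noncomputable def forwardShiftQuotient :
    (lp (fun _ : ℕ => ℂ) ∞ ⧸ c0) →L[ℂ] (lp (fun _ : ℕ => ℂ) ∞ ⧸ c0) :=
  (c0.mapQ c0 forwardShift fun _ => forwardShift_mem_c0).mkContinuous 1 fun q => by
    rw [one_mul]
    exact norm_quotient_map_le forwardShift norm_forwardShift_le _ (fun _ => rfl) q

theorem forwardShiftQuotient_mkQ (x : lp (fun _ : ℕ => ℂ) ∞) :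
    forwardShiftQuotient (c0.mkQ x) = c0.mkQ (forwardShift x) := rfl

theorem norm_le_one_of_mem_spectrum {E : Type*} [NormedAddCommGroup E] [NormedSpace ℂ E]
    [CompleteSpace E] (L : E →L[ℂ] E) (hL : ∀ q, ‖L q‖ ≤ ‖q‖) {z : ℂ}
    (hz : z ∈ spectrum ℂ L) : ‖z‖ ≤ 1 := by
  have h := spectrum.norm_le_norm_mul_of_mem hz
  have h₁ : ‖L‖ ≤ 1 := L.opNorm_le_bound zero_le_one fun q => by simpa using hL q
  have h₂ : ‖(1 : E →L[ℂ] E)‖ ≤ 1 := ContinuousLinearMap.norm_id_le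
  exact h.trans (mul_le_one₀ h₁ (norm_nonneg _) h₂)

/-- The bounded sequence `n ↦ z ^ n` for `z` on the unit circle. -/
noncomputable def powSeq (z : ℂ) (hz : ‖z‖ = 1) : lp (fun _ : ℕ => ℂ) ∞ :=
  ⟨fun n => z ^ n, memℓp_infty ⟨1, by
    rintro r ⟨n, rfl⟩
    simp [hz]⟩⟩

theorem powSeq_apply (z : ℂ) (hz : ‖z‖ = 1) (n : ℕ) : powSeq z hz n = z ^ n := rfl

theorem backwardShift_powSeq (z : ℂ) (hz : ‖z‖ = 1) :
    backwardShift (powSeq z hz) = z • powSeq z hz := by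
  ext n
  exact pow_succ' z n

theorem powSeq_notMem_c0 (z : ℂ) (hz : ‖z‖ = 1) : powSeq z hz ∉ c0 := fun h => by
  have h' := ((mem_c0_iff _).1 h).norm
  simp [powSeq_apply, hz] at h'

/-- The spectrum of the operator `B̂` induced by the backward shift `B` on the quotient
`l^∞(ℕ)/c₀(ℕ)` (i.e. any bounded operator with `B̂ ∘ π = π ∘ B`, where `π` is the
quotient map) equals the unit circle. -/
theorem stmt14
    (Bhat : (lp (fun _ : ℕ => ℂ) ∞ ⧸ c0) →L[ℂ] (lp (fun _ : ℕ => ℂ) ∞ ⧸ c0))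
    (hBhat : ∀ x : lp (fun _ : ℕ => ℂ) ∞, Bhat (c0.mkQ x) = c0.mkQ (backwardShift x)) :
    spectrum ℂ Bhat = {z : ℂ | ‖z‖ = 1} := by
  have h_right : Bhat * forwardShiftQuotient = 1 := by
    ext q
    obtain ⟨x, rfl⟩ := c0.mkQ_surjective q
    rw [mul_apply_eq_comp, forwardShiftQuotient_mkQ, hBhat,
      backwardShift_forwardShift, one_apply_eq_self]
  have h_left : forwardShiftQuotient * Bhat = 1 := by
    ext q
    obtain ⟨x, rfl⟩ := c0.mkQ_surjective q
    rw [mul_apply_eq_comp, hBhat, forwardShiftQuotient_mkQ,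
      one_apply_eq_self]
    exact (Submodule.Quotient.eq c0).2 (forwardShift_backwardShift_sub_mem_c0 x)
  let u : ((lp (fun _ : ℕ => ℂ) ∞ ⧸ c0) →L[ℂ] (lp (fun _ : ℕ => ℂ) ∞ ⧸ c0))ˣ :=
    ⟨Bhat, forwardShiftQuotient, h_right, h_left⟩
  ext z
  constructor
  · intro hz
    have h_le : ‖z‖ ≤ 1 := norm_le_one_of_mem_spectrum Bhat
      (norm_quotient_map_le backwardShift norm_backwardShift_le Bhat.toLinearMap hBhat) hz
    have hz0 : z ≠ 0 := spectrum.ne_zero_of_mem_of_unit (a := u) hz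
    have hz_inv : z⁻¹ ∈ spectrum ℂ forwardShiftQuotient :=
      (spectrum.inv_mem_iff (r := Units.mk0 z hz0) (a := u)).1 hz
    have h_inv_le : ‖z⁻¹‖ ≤ 1 := norm_le_one_of_mem_spectrum forwardShiftQuotient
      (norm_quotient_map_le forwardShift norm_forwardShift_le
        forwardShiftQuotient.toLinearMap forwardShiftQuotient_mkQ) hz_inv
    rw [norm_inv] at h_inv_le
    exact le_antisymm h_le ((inv_le_one₀ (norm_pos_iff.2 hz0)).1 h_inv_le)
  · intro hz
    refine spectrum.mem_iff.2 fun hu => ?_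
    obtain ⟨v, hv⟩ := hu.exists_left_inv
    have h_ker : (algebraMap ℂ _ z - Bhat) (c0.mkQ (powSeq z hz)) = 0 := by
      rw [sub_apply, hBhat, backwardShift_powSeq, map_smul]
      exact sub_self _
    have h_zero : c0.mkQ (powSeq z hz) = 0 := by
      have := congrArg (fun T => T (c0.mkQ (powSeq z hz))) hv
      simpa only [mul_apply_eq_comp, h_ker, map_zero,
        one_apply_eq_self] using this.symm
    exact powSeq_notMem_c0 z hz ((Submodule.Quotient.mk_eq_zero c0).1 h_zero)
end
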